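/- Let $n \geq 1$, let $f_0 : \mathbb{R} \to \mathbb{R}$ be any function, and define the likelihood $\mathcal{L}(x_1,\dots,x_n; c,\kappa) = \frac{\kappa^n}{\prod_{j=1}^n x_j} \prod_{j=1}^n \left(\frac{x_j}{c}\right)^{\kappa} f_0\left(\left(\frac{x_j}{c}\right)^{\kappa}\right)$ for samples with all $x_j > 0$ and parameters $c,\kappa > 0$. Fix a sample $x_1,\dots,x_n > 0$ and suppose $(\hat c, \hat\kappa)$ with $\hat c, \hat\kappa > 0$ maximizes $(c,\kappa) \mapsto \mathcal{L}(x_1,\dots,x_n; c,\kappa)$ over $(0,\infty)^2$. Then for all $a, b > 0$, the pair $(a\, \hat c^{1/b}, b\, \hat\kappa)$ maximizes $(d,\eta) \mapsto \mathcal{L}(a x_1^{1/b},\dots, a x_n^{1/b}; d, \eta)$ over $(0,\infty)^2$. -/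

import Mathlib

open Real Finset

/-- The likelihood of the sample `x` for the family with densities
`f_{c,κ}(t) = (κ/c)(t/c)^{κ-1} f₀((t/c)^κ)`. -/
noncomputable def likelihood (n : ℕ) (f0 : ℝ → ℝ) (x : Fin n → ℝ) (c κ : ℝ) : ℝ :=
  κ ^ n / (∏ j, x j) * ∏ j, ((x j / c) ^ κ * f0 ((x j / c) ^ κ))

lemma likelihood_transform (n : ℕ) (f0 : ℝ → ℝ)
    (x : Fin n → ℝ) (hx : ∀ j, 0 < x j) (a b : ℝ) (ha : 0 < a) (hb : 0 < b)
    (c κ : ℝ) (hc : 0 < c) :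
    likelihood n f0 (fun j => a * (x j) ^ (1 / b)) (a * c ^ (1 / b)) (b * κ)
      = (b ^ n * (∏ j, x j) / ∏ j, (a * (x j) ^ (1 / b))) * likelihood n f0 x c κ := by
  have key : ∀ j, (a * (x j) ^ (1 / b) / (a * c ^ (1 / b))) ^ (b * κ) = (x j / c) ^ κ := by
    intro j
    rw [mul_div_mul_left _ _ ha.ne', ← Real.div_rpow (hx j).le hc.le,
      ← Real.rpow_mul (div_pos (hx j) hc).le]
    congr 1
    field_simp
  have hp : (∏ j, x j) ≠ 0 := (Finset.prod_pos fun j _ => hx j).ne'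
  unfold likelihood
  simp only [key]
  rw [mul_pow]
  generalize (∏ j, a * (x j) ^ (1 / b)) = P
  field_simp

/-- Proposition 1: if `(ĉ, κ̂)` maximizes the likelihood of the sample `x` over
`(0,∞)²`, then `(a ĉ^{1/b}, b κ̂)` maximizes the likelihood of the transformed
sample `a x^{1/b}` over `(0,∞)²`. -/
theorem mle_equivariant (n : ℕ) (hn : 1 ≤ n) (f0 : ℝ → ℝ)
    (x : Fin n → ℝ) (hx : ∀ j, 0 < x j)
    (chat κhat : ℝ) (hchat : 0 < chat) (hκhat : 0 < κhat)
    (hmax : ∀ c κ : ℝ, 0 < c → 0 < κ →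
      likelihood n f0 x c κ ≤ likelihood n f0 x chat κhat)
    (a b : ℝ) (ha : 0 < a) (hb : 0 < b) :
    ∀ d η : ℝ, 0 < d → 0 < η →
      likelihood n f0 (fun j => a * (x j) ^ (1 / b)) d η
        ≤ likelihood n f0 (fun j => a * (x j) ^ (1 / b)) (a * chat ^ (1 / b)) (b * κhat) := by
  intro d η hd hη
  have hda : 0 < d / a := div_pos hd ha
  have h1 := likelihood_transform n f0 x hx a b ha hb ((d / a) ^ b) (η / b)
    (Real.rpow_pos_of_pos hda b)
  have e1 : a * ((d / a) ^ b) ^ (1 / b) = d := by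
    rw [← Real.rpow_mul hda.le, mul_one_div_cancel hb.ne', Real.rpow_one,
      mul_div_cancel₀ _ ha.ne']
  have e2 : b * (η / b) = η := mul_div_cancel₀ _ hb.ne'
  rw [e1, e2] at h1
  rw [h1, likelihood_transform n f0 x hx a b ha hb chat κhat hchat]
  refine mul_le_mul_of_nonneg_left
    (hmax _ _ (Real.rpow_pos_of_pos hda b) (div_pos hη hb)) ?_
  refine div_nonneg (mul_nonneg (pow_nonneg hb.le n)
    (Finset.prod_nonneg fun j _ => (hx j).le)) (Finset.prod_nonneg fun j _ => ?_)
  exact mul_nonneg ha.le (Real.rpow_nonneg (hx j).le _)
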